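/- For every state u in the saturation triangle Δ, the discriminant (tr J(u))² − 4·det J(u) of the Jacobian J(u) of the flux map F is nonnegative; consequently the two characteristic speeds (the eigenvalues of J(u)) are real at every point of Δ. -/

import Mathlib

open Matrix Polynomial

noncomputable section ThreePhaseFlow

/-- Oil saturation `s_o = 1 - s_w - s_g`. -/
def so (u : ℝ × ℝ) : ℝ := 1 - u.1 - u.2

/-- The denominator `D(u) = s_w^2/μ_w + s_g^2/μ_g + s_o^2/μ_o`. -/
def Dfun (μw μg μo : ℝ) (u : ℝ × ℝ) : ℝ :=
  u.1 ^ 2 / μw + u.2 ^ 2 / μg + so u ^ 2 / μo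

/-- Water fractional flow `f_w`. -/
def fw (μw μg μo : ℝ) (u : ℝ × ℝ) : ℝ := u.1 ^ 2 / (μw * Dfun μw μg μo u)

/-- Gas fractional flow `f_g`. -/
def fg (μw μg μo : ℝ) (u : ℝ × ℝ) : ℝ := u.2 ^ 2 / (μg * Dfun μw μg μo u)

/-- Oil fractional flow `f_o`. -/
def fo (μw μg μo : ℝ) (u : ℝ × ℝ) : ℝ := so u ^ 2 / (μo * Dfun μw μg μo u)

/-- The flux map `F(u) = (f_w(u), f_g(u))`. -/
def flux (μw μg μo : ℝ) (u : ℝ × ℝ) : ℝ × ℝ :=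
  (fw μw μg μo u, fg μw μg μo u)

/-- The saturation triangle `Δ`. -/
def satTriangle : Set (ℝ × ℝ) := {u | 0 ≤ u.1 ∧ 0 ≤ u.2 ∧ u.1 + u.2 ≤ 1}

/-- The Jacobian matrix `J(u)` of the flux map at `u`. -/
def jac (μw μg μo : ℝ) (u : ℝ × ℝ) : Matrix (Fin 2) (Fin 2) ℝ :=
  !![fderiv ℝ (fw μw μg μo) u (1, 0), fderiv ℝ (fw μw μg μo) u (0, 1);
     fderiv ℝ (fg μw μg μo) u (1, 0), fderiv ℝ (fg μw μg μo) u (0, 1)]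

/-- Derivative of `s^2/(m * D)` for a linear functional `s`. -/
theorem quad_frac_fderiv (s D : ℝ × ℝ → ℝ) (s' D' : ℝ × ℝ →L[ℝ] ℝ) (u : ℝ × ℝ) (m : ℝ)
    (hm : m ≠ 0) (hs : HasFDerivAt s s' u) (hD : HasFDerivAt D D' u) (h0 : D u ≠ 0)
    (v : ℝ × ℝ) :
    fderiv ℝ (fun w => s w ^ 2 / (m * D w)) u v
      = (2 * (s u / m) * s' v * D u - s u * (s u / m) * D' v) / D u ^ 2 := by
  have hi := (hasDerivAt_inv (mul_ne_zero hm h0)).comp_hasFDerivAt u (hD.const_mul m)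
  have h := (hs.pow 2).mul hi
  have h' : HasFDerivAt (fun w => s w ^ 2 / (m * D w)) _ u := h
  rw [h'.fderiv]
  simp
  field_simp
  ring

theorem Dfun_hasFDerivAt (μw μg μo : ℝ) (u : ℝ × ℝ) :
    HasFDerivAt (Dfun μw μg μo)
      ((2 * (u.1 / μw - so u / μo)) • ContinuousLinearMap.fst ℝ ℝ ℝ
        + (2 * (u.2 / μg - so u / μo)) • ContinuousLinearMap.snd ℝ ℝ ℝ) u := by
  have h1 : HasFDerivAt (fun w : ℝ × ℝ => w.1) (ContinuousLinearMap.fst ℝ ℝ ℝ) u := hasFDerivAt_fst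
  have h2 : HasFDerivAt (fun w : ℝ × ℝ => w.2) (ContinuousLinearMap.snd ℝ ℝ ℝ) u := hasFDerivAt_snd
  have h3 := (h1.const_sub 1).sub h2
  have h := (((h1.pow 2).mul_const μw⁻¹).add ((h2.pow 2).mul_const μg⁻¹)).add
    ((h3.pow 2).mul_const μo⁻¹)
  refine (h.congr_fderiv ?_)
  ext <;> simp [so] <;> ring

theorem Dfun_pos (μw μg μo : ℝ) (hw : 0 < μw) (hg : 0 < μg) (ho : 0 < μo) (u : ℝ × ℝ) :
    0 < Dfun μw μg μo u := by
  unfold Dfun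
  by_cases h1 : u.1 = 0
  · by_cases h2 : u.2 = 0
    · simp [h1, h2, so, ho]
    · positivity
  · positivity

theorem disc_of_point (T d t : ℝ) (h : t ^ 2 - T * t + d ≤ 0) : 0 ≤ T ^ 2 - 4 * d := by
  nlinarith [sq_nonneg (2 * t - T)]

theorem median_cases (a b c : ℝ) :
    (a - c) * (b - c) ≤ 0 ∨ (b - a) * (c - a) ≤ 0 ∨ (a - b) * (c - b) ≤ 0 := by
  by_contra! h
  obtain ⟨h1, h2, h3⟩ := h
  rcases mul_pos_iff.1 h1 with h1 | h1 <;> rcases mul_pos_iff.1 h2 with h2 | h2 <;>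
    rcases mul_pos_iff.1 h3 with h3 | h3 <;> linarith [h1.1, h1.2, h2.1, h2.2, h3.1, h3.2]

theorem disc_alg (a b c p q r D : ℝ) (hp : 0 ≤ p) (hq : 0 ≤ q) (hr : 0 ≤ r) (hD : 0 < D)
    (hs : D = p + q + r) :
    0 ≤ ((a * D - p * (a - c)) + (b * D - q * (b - c))) ^ 2
      - 4 * ((a * D - p * (a - c)) * (b * D - q * (b - c)) - (p * (b - c)) * (q * (a - c))) := by
  rcases median_cases a b c with h | h | h
  · apply disc_of_point _ _ (c * D)
    have := mul_nonpos_of_nonneg_of_nonpos (mul_nonneg hD.le hr) h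
    subst hs
    linarith
  · apply disc_of_point _ _ (a * D)
    have := mul_nonpos_of_nonneg_of_nonpos (mul_nonneg hD.le hp) h
    subst hs
    linarith
  · apply disc_of_point _ _ (b * D)
    have := mul_nonpos_of_nonneg_of_nonpos (mul_nonneg hD.le hq) h
    subst hs
    linarith

theorem jac_disc (μw μg μo : ℝ) (hw : 0 < μw) (hg : 0 < μg) (ho : 0 < μo)
    (u : ℝ × ℝ) :
    0 ≤ (jac μw μg μo u).trace ^ 2 - 4 * (jac μw μg μo u).det := by
  have hD := Dfun_pos μw μg μo hw hg ho u
  have hd := Dfun_hasFDerivAt μw μg μo u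
  have e1 : ∀ v, fderiv ℝ (fw μw μg μo) u v = _ :=
    quad_frac_fderiv _ _ _ _ u μw hw.ne' hasFDerivAt_fst hd hD.ne'
  have e2 : ∀ v, fderiv ℝ (fg μw μg μo) u v = _ :=
    quad_frac_fderiv _ _ _ _ u μg hg.ne' hasFDerivAt_snd hd hD.ne'
  have hs : Dfun μw μg μo u = u.1 ^ 2 / μw + u.2 ^ 2 / μg + so u ^ 2 / μo := rfl
  have key := disc_alg (u.1 / μw) (u.2 / μg) (so u / μo) (u.1 ^ 2 / μw) (u.2 ^ 2 / μg)
    (so u ^ 2 / μo) (Dfun μw μg μo u) (by positivity) (by positivity) (by positivity) hD hs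
  have key2 := mul_nonneg (show 0 ≤ 4 / Dfun μw μg μo u ^ 4 by positivity) key
  rw [Matrix.trace_fin_two, Matrix.det_fin_two]
  simp only [jac, e1, e2]
  clear hs
  generalize Dfun μw μg μo u = D at *
  refine key2.trans_eq ?_
  simp
  field_simp
  ring

/-- on the saturation triangle the discriminant of the Jacobian is
nonnegative, hence the two characteristic speeds (eigenvalues of `J(u)`) are real. -/
theorem discriminant_nonneg (μw μg μo : ℝ) (hw : 0 < μw) (hg : 0 < μg) (ho : 0 < μo) :
    ∀ u ∈ satTriangle,
      0 ≤ (jac μw μg μo u).trace ^ 2 - 4 * (jac μw μg μo u).det ∧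
      ∃ lam₁ lam₂ : ℝ,
        (jac μw μg μo u).charpoly = (X - C lam₁) * (X - C lam₂) := by
  intro u _
  have h := jac_disc μw μg μo hw hg ho u
  refine ⟨h, ?_⟩
  set T := (jac μw μg μo u).trace with hT
  set d := (jac μw μg μo u).det with hd
  have hq := Real.sq_sqrt h
  set q := Real.sqrt (T ^ 2 - 4 * d)
  refine ⟨(T + q) / 2, (T - q) / 2, ?_⟩
  rw [Matrix.charpoly_fin_two, ← hT, ← hd]
  have h1 : T = (T + q) / 2 + (T - q) / 2 := by ring
  have h2 : d = (T + q) / 2 * ((T - q) / 2) := by linarith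
  generalize (T + q) / 2 = x at *
  generalize (T - q) / 2 = y at *
  rw [h1, h2, C_add, C_mul]
  ring

end ThreePhaseFlow
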